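/- arXiv:2208.13532 — 2 statements merged into one kernel-verified Lean document; each statement's English description precedes it below -/
import Mathlib

section
/- Let n, μ, h > 0 with μ ≤ n, 0 < h < √(μn) (so that μn/h > √(μn)), and μ(√(μn) − μ) ≤ σ² ≤ μ(μn/h − μ). Let P* be the discrete measure placing mass p_s = (μ² + σ² − μ·(μn/h)) / (√(μn)·(√(μn) − μn/h)) at √(μn), mass p_l = (μ² + σ² − μ·√(μn)) / ((μn/h)·(μn/h − √(μn))) at μn/h, and mass 1 − p_s − p_l at 0. Then P* is a probability measure with mean μ and second moment μ² + σ², and for X₁, X₂ i.i.d. with law P*, c_{P*}(h) = (n²/h²)·E[ min(X₁X₂/(μn),1)·min(hX₁/(μn),1)·min(hX₂/(μn),1) ] = 1. -/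
open MeasureTheory

theorem integral_three_dirac {a b c : ℝ} (ha : 0 ≤ a) (hb : 0 ≤ b) (hc : 0 ≤ c) (s l z : ℝ)
    (f : ℝ → ℝ) :
    ∫ x, f x ∂(ENNReal.ofReal a • Measure.dirac s + ENNReal.ofReal b • Measure.dirac l
      + ENNReal.ofReal c • Measure.dirac z) = a * f s + b * f l + c * f z := by
  have hi (d : ℝ) (t : ℝ) : Integrable f (ENNReal.ofReal d • Measure.dirac t) :=
    (integrable_dirac (by simp)).smul_measure ENNReal.ofReal_ne_top
  rw [integral_add_measure ((hi a s).add_measure (hi b l)) (hi c z),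
    integral_add_measure (hi a s) (hi b l)]
  simp [integral_smul_measure, ha, hb, hc]

/-- For `0 < h < √(μn)` and `μ(√(μn) − μ) ≤ σ² ≤ μ(μn/h − μ)`, the
three-point distribution with mass `p_s` at `√(μn)`, mass `p_l` at `μn/h` and the
remaining mass at `0` is a probability measure with mean `μ` and second moment
`μ² + σ²`, and for `X₁, X₂` i.i.d. with this law, `c_{P*}(h) = 1`. -/
theorem three_point_attains_clustering_one
    (n μ h σ2 : ℝ) (hn : 0 < n) (hμ : 0 < μ) (hμn : μ ≤ n)
    (hh : 0 < h) (hhs : h < Real.sqrt (μ * n))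
    (hσ2lb : μ * (Real.sqrt (μ * n) - μ) ≤ σ2)
    (hσ2ub : σ2 ≤ μ * (μ * n / h - μ))
    (P : Measure ℝ)
    (hP : P = ENNReal.ofReal
          ((μ ^ 2 + σ2 - μ * (μ * n / h)) /
            (Real.sqrt (μ * n) * (Real.sqrt (μ * n) - μ * n / h))) •
          Measure.dirac (Real.sqrt (μ * n))
        + ENNReal.ofReal
          ((μ ^ 2 + σ2 - μ * Real.sqrt (μ * n)) /
            ((μ * n / h) * (μ * n / h - Real.sqrt (μ * n)))) •
          Measure.dirac (μ * n / h)
        + ENNReal.ofReal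
          (1 - (μ ^ 2 + σ2 - μ * (μ * n / h)) /
              (Real.sqrt (μ * n) * (Real.sqrt (μ * n) - μ * n / h))
            - (μ ^ 2 + σ2 - μ * Real.sqrt (μ * n)) /
              ((μ * n / h) * (μ * n / h - Real.sqrt (μ * n)))) •
          Measure.dirac (0 : ℝ)) :
    IsProbabilityMeasure P ∧
    (∫ x, x ∂P) = μ ∧
    (∫ x, x ^ 2 ∂P) = μ ^ 2 + σ2 ∧
    (n ^ 2 / h ^ 2) *
        ∫ x, ∫ y, min (x * y / (μ * n)) 1 * min (h * x / (μ * n)) 1 *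
          min (h * y / (μ * n)) 1 ∂P ∂P
      = 1 := by
  set s := Real.sqrt (μ * n) with hs
  have hs0 : 0 < s := Real.sqrt_pos.mpr (mul_pos hμ hn)
  have hs2 : μ * n = s ^ 2 := (Real.sq_sqrt (mul_pos hμ hn).le).symm
  have hμs : μ ≤ s := Real.le_sqrt_of_sq_le (by nlinarith)
  rw [hs2] at hP hσ2ub
  rw [hs2]
  set L := s ^ 2 / h with hL
  have hLh : h * L = s ^ 2 := by rw [hL]; field_simp
  have hsL : s < L := by rw [hL, lt_div_iff₀ hh]; nlinarith
  have hL0 : 0 < L := hs0.trans hsL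
  have hLs : L - s ≠ 0 := (sub_pos.mpr hsL).ne'
  have hsL' : s - L ≠ 0 := (sub_neg.mpr hsL).ne
  set a := (μ ^ 2 + σ2 - μ * L) / (s * (s - L)) with ha
  set b := (μ ^ 2 + σ2 - μ * s) / (L * (L - s)) with hb
  have ha0 : 0 ≤ a := div_nonneg_of_nonpos (by linarith)
    (mul_nonpos_of_nonneg_of_nonpos hs0.le (by linarith))
  have hb0 : 0 ≤ b := div_nonneg (by linarith) (mul_nonneg hL0.le (by linarith))
  have ha' : a * s * (L - s) = μ * L - (μ ^ 2 + σ2) := by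
    rw [ha]; field_simp; ring
  have hb' : b * L * (L - s) = μ ^ 2 + σ2 - μ * s := by
    rw [hb]; field_simp
  have hmean : a * s + b * L = μ := mul_right_cancel₀ hLs (by linear_combination ha' + hb')
  have hsecond : a * s ^ 2 + b * L ^ 2 = μ ^ 2 + σ2 :=
    mul_right_cancel₀ hLs (by linear_combination s * ha' + L * hb')
  have hc0 : 0 ≤ 1 - a - b := by
    have : (a + b) * s ≤ 1 * s := by nlinarith
    linarith [le_of_mul_le_mul_right this hs0]
  have hint (f : ℝ → ℝ) : ∫ x, f x ∂P = a * f s + b * f L + (1 - a - b) * f 0 := by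
    rw [hP, integral_three_dirac ha0 hb0 hc0]
  refine ⟨⟨?_⟩, ?_, ?_, ?_⟩
  · rw [hP]
    simp only [Measure.add_apply, Measure.smul_apply, measure_univ, smul_eq_mul, mul_one]
    rw [← ENNReal.ofReal_add ha0 hb0, ← ENNReal.ofReal_add (add_nonneg ha0 hb0) hc0]
    simp
  · rw [hint]; linarith
  · rw [hint]; linarith
  · have hs2pos : 0 < s ^ 2 := pow_pos hs0 2
    have hedge {x y : ℝ} (hx : s ≤ x) (hy : s ≤ y) : min (x * y / s ^ 2) 1 = 1 :=
      min_eq_right ((one_le_div hs2pos).mpr (by nlinarith))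
    have hfs : min (h * s / s ^ 2) 1 = s / L := by
      rw [min_eq_left ((div_le_one hs2pos).mpr (by nlinarith)), ← hLh]
      field_simp
    have hfL : min (h * L / s ^ 2) 1 = 1 := by rw [hLh, div_self hs2pos.ne', min_self]
    have hscale : n * μ = h * L := by rw [hLh, ← hs2, mul_comm]
    simp only [hint, hedge le_rfl le_rfl, hedge le_rfl hsL.le, hedge hsL.le le_rfl,
      hedge hsL.le hsL.le, hfs, hfL]
    simp only [mul_zero, zero_mul, zero_div, min_eq_left zero_le_one, add_zero, one_mul, mul_one]
    have hweight : a * (s / L) + b = μ / L := by rw [← hmean]; field_simp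
    calc _ = n ^ 2 / h ^ 2 * (a * (s / L) + b) ^ 2 := by ring
      _ = (n * μ / (h * L)) ^ 2 := by rw [hweight]; field_simp
      _ = 1 := by rw [hscale, div_self (mul_pos hh hL0).ne', one_pow]
end

section
/- Let n, μ, h, h_c > 0 with h ≤ n, set l = min(μn/h, h_c), and assume μ < l, d ≥ 0, and d/(2μ) + d/(2(l−μ)) ≤ 1. Then the discrete measure P* placing mass d/(2μ) at 0, mass d/(2(l−μ)) at l, and mass 1 − d/(2μ) − d/(2(l−μ)) at μ is a probability measure on [0, h_c] with mean μ and mean absolute deviation ∫|x−μ| dP* = d, and it satisfies a_{P*}(h) = (n/h)·∫ x·min(hx/(μn), 1) dP*(x) = μ + d·l/(2μ). -/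
open MeasureTheory

/-- The integral against a weighted sum of three Dirac masses. -/
theorem integral_three_dirac_s15 (f : ℝ → ℝ) {p q r : ℝ} (hp : 0 ≤ p) (hq : 0 ≤ q) (hr : 0 ≤ r)
    (a b c : ℝ) :
    ∫ x, f x ∂(ENNReal.ofReal p • Measure.dirac a + ENNReal.ofReal q • Measure.dirac b
      + ENNReal.ofReal r • Measure.dirac c) = p * f a + q * f b + r * f c := by
  have h_int : ∀ t y : ℝ, Integrable f (ENNReal.ofReal t • Measure.dirac y) := fun t y =>
    (integrable_dirac (by simp)).smul_measure ENNReal.ofReal_ne_top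
  rw [integral_add_measure ((h_int p a).add_measure (h_int q b)) (h_int r c),
    integral_add_measure (h_int p a) (h_int q b)]
  simp [integral_smul_measure, ENNReal.toReal_ofReal, hp, hq, hr]

/-- The three-point distribution with mass `d/(2μ)` at `0`, mass
`d/(2(l−μ))` at `l = min(μn/h, h_c)` and the remaining mass at `μ` is a probability
measure on `[0, h_c]` with mean `μ` and mean absolute deviation `d`, and it attains
`a_P(h) = μ + d l/(2μ)`. -/
theorem three_point_attains_annd_mad
    (n μ h h_c l d : ℝ) (hn : 0 < n) (hμ : 0 < μ) (hh : 0 < h) (hhc : 0 < h_c)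
    (hhn : h ≤ n) (hl : l = min (μ * n / h) h_c) (hμl : μ < l) (hd : 0 ≤ d)
    (hdub : d / (2 * μ) + d / (2 * (l - μ)) ≤ 1)
    (P : Measure ℝ)
    (hP : P = ENNReal.ofReal (d / (2 * μ)) • Measure.dirac (0 : ℝ)
        + ENNReal.ofReal (d / (2 * (l - μ))) • Measure.dirac l
        + ENNReal.ofReal (1 - d / (2 * μ) - d / (2 * (l - μ))) • Measure.dirac μ) :
    IsProbabilityMeasure P ∧
    P (Set.Icc 0 h_c)ᶜ = 0 ∧
    (∫ x, x ∂P) = μ ∧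
    (∫ x, |x - μ| ∂P) = d ∧
    (n / h) * ∫ x, x * min (h * x / (μ * n)) 1 ∂P = μ + d * l / (2 * μ) := by
  have hlμ : 0 < l - μ := sub_pos.2 hμl
  have hl0 : 0 < l := hμ.trans hμl
  have hlc : l ≤ h_c := hl ▸ min_le_right _ _
  have hlh : h * l ≤ μ * n := by
    have hln : l ≤ μ * n / h := hl ▸ min_le_left _ _
    rw [le_div_iff₀ hh] at hln
    linarith
  have hp : 0 ≤ d / (2 * μ) := by positivity
  have hq : 0 ≤ d / (2 * (l - μ)) := by positivity
  have hr : 0 ≤ 1 - d / (2 * μ) - d / (2 * (l - μ)) := by linarith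
  have hμn : 0 < μ * n := by positivity
  subst hP
  refine ⟨⟨?_⟩, ?_, ?_, ?_, ?_⟩
  · simp only [Measure.add_apply, Measure.smul_apply, measure_univ, smul_eq_mul, mul_one]
    rw [← ENNReal.ofReal_add hp hq, ← ENNReal.ofReal_add (add_nonneg hp hq) hr]
    ring_nf
    simp
  · simp [Measure.dirac_apply' _ measurableSet_Icc.compl, hhc.le, hl0.le, hlc, hμ.le,
      hμl.le.trans hlc]
  · rw [integral_three_dirac_s15 (fun x => x) hp hq hr]
    field_simp
    ring
  · rw [integral_three_dirac_s15 (fun x => |x - μ|) hp hq hr, abs_of_pos hlμ, zero_sub, abs_neg,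
      abs_of_pos hμ, sub_self, abs_zero]
    field_simp
    ring
  · rw [integral_three_dirac_s15 (fun x => x * min (h * x / (μ * n)) 1) hp hq hr,
      min_eq_left ((div_le_one hμn).2 hlh),
      min_eq_left ((div_le_one hμn).2 (by nlinarith : h * μ ≤ μ * n))]
    field_simp
    ring
end
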